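/- Let p, q be positive integers, n ≥ 2, and a ∈ (0, 1/√2). Let (u, v₁, v₂) ∈ ℂ^{n−1}×ℂ×ℂ with ‖u‖² = 1 − 2a², |v₁| = |v₂| = a. Set X₁ := (0, i·v₁, 0), X₂ := (0, 0, i·v₂) and w := (i·p·u, i·q·v₁, i·q·v₂). Then the horizontal parts X₁ʰ and X₂ʰ with respect to w are nonzero and the angle between them, i.e., arccos(⟨X₁ʰ, X₂ʰ⟩/(‖X₁ʰ‖·‖X₂ʰ‖)), equals arccos(−q²a²/(p²(1−2a²) + q²a²)). -/

import Mathlib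

open Matrix

/-- The Hermitian inner product `⟪z,w⟫ = ∑ k, z k * conj (w k)` on `ℂᵐ`. -/
noncomputable def hinner {m : ℕ} (z w : Fin m → ℂ) : ℂ :=
  ∑ k, z k * (starRingEnd ℂ) (w k)

/-- The real inner product `⟨z,w⟩ = Re ⟪z,w⟫` on `ℂᵐ`. -/
noncomputable def rinner {m : ℕ} (z w : Fin m → ℂ) : ℝ := (hinner z w).re

/-- The squared norm `‖z‖² = ⟨z,z⟩` on `ℂᵐ`. -/
noncomputable def nsq {m : ℕ} (z : Fin m → ℂ) : ℝ := rinner z z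

/-- The 1-form `κ^j_u(U) = ‖u‖²⟨ju,U⟩ − ⟨U,iu⟩⟨ju,iu⟩` associated with a matrix `j`. -/
noncomputable def kappa {m : ℕ} (j : Matrix (Fin m) (Fin m) ℂ) (u U : Fin m → ℂ) : ℝ :=
  nsq u * rinner (j.mulVec u) U -
    rinner U (Complex.I • u) * rinner (j.mulVec u) (Complex.I • u)

/-- The space `ℂᵐ × ℂ × ℂ`. -/
abbrev E (m : ℕ) := (Fin m → ℂ) × ℂ × ℂ

/-- The real inner product `⟨z,w⟩ = Re(z·conj w)` on `ℂ`. -/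
noncomputable def rc (z w : ℂ) : ℝ := (z * (starRingEnd ℂ) w).re

/-- The real inner product on `ℂᵐ × ℂ × ℂ`. -/
noncomputable def ripE {m : ℕ} (x y : E m) : ℝ :=
  rinner x.1 y.1 + rc x.2.1 y.2.1 + rc x.2.2 y.2.2

/-- The horizontal part `Xʰ = X − (⟨X,w⟩/‖w‖²)·w` of `X` with respect to `w`. -/
noncomputable def hor {m : ℕ} (w X : E m) : E m :=
  X - (ripE X w / ripE w w) • w

theorem rc_comm (z w : ℂ) : rc z w = rc w z := by
  simp [rc, Complex.mul_re]
  ring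

theorem rc_sub_smul_left (z w y : ℂ) (t : ℝ) : rc (z - t • w) y = rc z y - t * rc w y := by
  simp [rc, Complex.mul_re]
  ring

theorem rinner_eq_sum_rc {m : ℕ} (z w : Fin m → ℂ) : rinner z w = ∑ k, rc (z k) (w k) := by
  simp [rinner, hinner, rc]

theorem rinner_comm {m : ℕ} (z w : Fin m → ℂ) : rinner z w = rinner w z := by
  simp only [rinner_eq_sum_rc, rc_comm]

theorem rinner_sub_smul_left {m : ℕ} (z w y : Fin m → ℂ) (t : ℝ) :
    rinner (z - t • w) y = rinner z y - t * rinner w y := by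
  simp only [rinner_eq_sum_rc, Pi.sub_apply, Pi.smul_apply, rc_sub_smul_left,
    Finset.sum_sub_distrib, Finset.mul_sum]

theorem rinner_smul_smul {m : ℕ} (c : ℂ) (z w : Fin m → ℂ) :
    rinner (c • z) (c • w) = ‖c‖ ^ 2 * rinner z w := by
  simp only [rinner_eq_sum_rc, Finset.mul_sum, Pi.smul_apply, smul_eq_mul]
  refine Finset.sum_congr rfl fun k _ => ?_
  simp only [rc, Complex.sq_norm, Complex.normSq_apply, map_mul, Complex.mul_re, Complex.mul_im,
    Complex.conj_re, Complex.conj_im]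
  ring

theorem ripE_comm {m : ℕ} (x y : E m) : ripE x y = ripE y x := by
  simp only [ripE, rinner_comm x.1, rc_comm x.2.1, rc_comm x.2.2]

theorem ripE_sub_smul_left {m : ℕ} (x w y : E m) (t : ℝ) :
    ripE (x - t • w) y = ripE x y - t * ripE w y := by
  simp only [ripE, Prod.fst_sub, Prod.snd_sub, Prod.smul_fst, Prod.smul_snd,
    rinner_sub_smul_left, rc_sub_smul_left]
  ring

theorem ripE_hor_hor {m : ℕ} {w : E m} (hw : ripE w w ≠ 0) (x y : E m) :
    ripE (hor w x) (hor w y) = ripE x y - ripE x w * ripE y w / ripE w w := by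
  have h : ripE w (hor w y) = 0 := by
    rw [ripE_comm, hor, ripE_sub_smul_left, div_mul_cancel₀ _ hw, sub_self]
  rw [hor, ripE_sub_smul_left, h, mul_zero, sub_zero, ripE_comm, hor, ripE_sub_smul_left,
    ripE_comm y x, ripE_comm w x]
  ring

theorem ripE_zero_left {m : ℕ} (y : E m) : ripE 0 y = 0 := by
  simp [ripE, rinner_eq_sum_rc, rc]

theorem rc_I_mul_natCast_mul (q : ℕ) (v : ℂ) :
    rc (Complex.I * v) (q * Complex.I * v) = q * ‖v‖ ^ 2 := by
  simp [rc, Complex.sq_norm, Complex.normSq_apply]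
  ring

theorem rc_self (v : ℂ) : rc v v = ‖v‖ ^ 2 := by
  simp [rc, Complex.sq_norm, Complex.normSq_apply]

/-- Corollary 4.13(ii) of the paper: the angle between the horizontal parts of
`X₁ = (0, iv₁, 0)` and `X₂ = (0, 0, iv₂)` at a point of `O_{a,a}` equals
`arccos(−q²a²/(p²(1−2a²)+q²a²))`. -/
theorem horizontal_angle (p q n : ℕ) (hp : 0 < p) (hq : 0 < q) (hn : 2 ≤ n)
    (a : ℝ) (ha : a ∈ Set.Ioo 0 (1 / Real.sqrt 2))
    (u : Fin (n - 1) → ℂ) (v₁ v₂ : ℂ)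
    (hu : nsq u = 1 - 2 * a ^ 2) (hv1 : ‖v₁‖ = a) (hv2 : ‖v₂‖ = a)
    (X₁ X₂ w : E (n - 1))
    (hX1 : X₁ = (0, Complex.I * v₁, 0)) (hX2 : X₂ = (0, 0, Complex.I * v₂))
    (hw : w = (((p : ℂ) * Complex.I) • u, (q : ℂ) * Complex.I * v₁, (q : ℂ) * Complex.I * v₂)) :
    hor w X₁ ≠ 0 ∧ hor w X₂ ≠ 0 ∧
    Real.arccos (ripE (hor w X₁) (hor w X₂) /
        (Real.sqrt (ripE (hor w X₁) (hor w X₁)) * Real.sqrt (ripE (hor w X₂) (hor w X₂)))) =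
      Real.arccos (-((q : ℝ) ^ 2 * a ^ 2) / ((p : ℝ) ^ 2 * (1 - 2 * a ^ 2) + (q : ℝ) ^ 2 * a ^ 2)) := by
  obtain ⟨ha0, ha1⟩ := ha
  have hp' : (0 : ℝ) < p := Nat.cast_pos.mpr hp
  have hq' : (0 : ℝ) < q := Nat.cast_pos.mpr hq
  have ha2 : 0 < 1 - 2 * a ^ 2 := by
    have h := (lt_div_iff₀ (Real.sqrt_pos.mpr two_pos)).mp ha1
    have h0 : 0 < a * Real.sqrt 2 := by positivity
    have h2 : (a * Real.sqrt 2) ^ 2 = 2 * a ^ 2 := by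
      rw [mul_pow, Real.sq_sqrt two_pos.le, mul_comm]
    nlinarith
  have hz (y : ℂ) : rc 0 y = 0 := by simp [rc]
  have hz' (y : ℂ) : rc y 0 = 0 := by simp [rc]
  have hzu (y : Fin (n - 1) → ℂ) : rinner 0 y = 0 := by simp [rinner_eq_sum_rc, hz]
  have hww : ripE w w = (p : ℝ) ^ 2 * (1 - 2 * a ^ 2) + 2 * ((q : ℝ) ^ 2 * a ^ 2) := by
    rw [nsq] at hu
    simp only [hw, ripE, rinner_smul_smul, hu, rc_self, norm_mul, Complex.norm_I,
      Complex.norm_natCast, hv1, hv2]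
    ring
  have h1w : ripE X₁ w = q * a ^ 2 := by
    simp [hX1, hw, ripE, hz, hzu, rc_I_mul_natCast_mul, hv1]
  have h2w : ripE X₂ w = q * a ^ 2 := by
    simp [hX2, hw, ripE, hz, hzu, rc_I_mul_natCast_mul, hv2]
  have h11 : ripE X₁ X₁ = a ^ 2 := by
    simp [hX1, ripE, hz, hzu, rc_self, hv1]
  have h22 : ripE X₂ X₂ = a ^ 2 := by
    simp [hX2, ripE, hz, hzu, rc_self, hv2]
  have h12 : ripE X₁ X₂ = 0 := by
    simp [hX1, hX2, ripE, hz, hz', hzu]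
  have hD : 0 < (p : ℝ) ^ 2 * (1 - 2 * a ^ 2) + (q : ℝ) ^ 2 * a ^ 2 := by positivity
  have hW : 0 < ripE w w := by rw [hww]; positivity
  set D := (p : ℝ) ^ 2 * (1 - 2 * a ^ 2) + (q : ℝ) ^ 2 * a ^ 2 with hDdef
  have hWD : ripE w w = D + (q : ℝ) ^ 2 * a ^ 2 := by rw [hww, hDdef]; ring
  have e1 : ripE (hor w X₁) (hor w X₁) = a ^ 2 * D / ripE w w := by
    rw [ripE_hor_hor hW.ne', h11, h1w, eq_div_iff hW.ne', sub_mul, div_mul_cancel₀ _ hW.ne', hWD]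
    ring
  have e2 : ripE (hor w X₂) (hor w X₂) = a ^ 2 * D / ripE w w := by
    rw [ripE_hor_hor hW.ne', h22, h2w, eq_div_iff hW.ne', sub_mul, div_mul_cancel₀ _ hW.ne', hWD]
    ring
  have e12 : ripE (hor w X₁) (hor w X₂) = -((q : ℝ) ^ 2 * a ^ 4) / ripE w w := by
    rw [ripE_hor_hor hW.ne', h12, h1w, h2w]
    ring
  have hpos : 0 < a ^ 2 * D / ripE w w := by positivity
  refine ⟨fun h => ?_, fun h => ?_, ?_⟩
  · rw [h, ripE_zero_left] at e1
    exact hpos.ne e1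
  · rw [h, ripE_zero_left] at e2
    exact hpos.ne e2
  · rw [e1, e2, e12, Real.mul_self_sqrt hpos.le]
    congr 1
    field_simp
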